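/- arXiv:2507.16734 — 2 statements merged into one kernel-verified Lean document; each statement's English description precedes it below -/
import Mathlib

section
/- Let D be a positive integer, Γ ⊆ ℝ^D, ε > 0, and let d be an integer for which there exists an orthogonal projection Π onto a d-dimensional linear subspace of ℝ^D with sup_{θ ∈ Γ} ‖θ − Πθ‖₂ ≤ ε/3. Define the test ψ(X, Y, Z) = 1[ ‖Π(θ̂_X − θ̂_Z)‖₂² ≥ ‖Π(θ̂_Y − θ̂_Z)‖₂² ], where θ̂_X = (1/n)Σᵢ Xᵢ, θ̂_Y = (1/n)Σᵢ Yᵢ, θ̂_Z = (1/m)Σⱼ Zⱼ. If m ≥ 96/ε², n ≥ 96·√d/ε², and m·n ≥ 768·d/ε⁴, then for all θ¹, θ², θ ∈ Γ with ‖θ¹ − θ²‖₂ ≥ ε and θ ∈ {θ¹, θ²}, when X₁,…,X_n are i.i.d. N(θ¹, I_D), Y₁,…,Y_n are i.i.d. N(θ², I_D), and Z₁,…,Z_m are i.i.d. N(θ, I_D), all mutually independent, the test errs with probability at most 1/4: P(ψ(X,Y,Z) = 1) ≤ 1/4 if θ = θ¹, and P(ψ(X,Y,Z) = 0) ≤ 1/4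 if θ = θ². -/
open MeasureTheory ProbabilityTheory Real

/-- The standard multivariate Gaussian `N(θ, I_D)` on `ℝ^D`, as a product of
one-dimensional Gaussians with unit variance. -/
noncomputable def gaussPi {D : ℕ} (θ : Fin D → ℝ) : Measure (Fin D → ℝ) :=
  Measure.pi (fun i => gaussianReal (θ i) 1)

/-- The joint law of `n` i.i.d. samples from `ν`. -/
noncomputable def iidSamples {E : Type*} [MeasurableSpace E] (n : ℕ) (ν : Measure E) :
    Measure (Fin n → E) :=
  Measure.pi (fun _ => ν)

/-- Euclidean norm on `ℝ^D`. -/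
noncomputable def euclNorm {D : ℕ} (θ : Fin D → ℝ) : ℝ :=
  Real.sqrt (∑ i, (θ i) ^ 2)

/-- A set `Γ ⊆ ℝ^D` is orthosymmetric if it is closed under coordinatewise sign flips. -/
def Orthosymmetric {D : ℕ} (Γ : Set (Fin D → ℝ)) : Prop :=
  ∀ θ ∈ Γ, ∀ s : Fin D → ℝ, (∀ i, s i = 1 ∨ s i = -1) → (fun i => s i * θ i) ∈ Γ

/-- Goodness-of-fit sample complexity: the smallest `n` for which there is a measurable test
`ψ` with type-I error at most `1/4` under `N(0, I_D)` and type-II error at most `1/4` under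
every `N(θ, I_D)` with `θ ∈ Γ`, `‖θ‖₂ ≥ ε`. -/
noncomputable def nGof {D : ℕ} (Γ : Set (Fin D → ℝ)) (ε : ℝ) : ℕ :=
  sInf {n : ℕ | ∃ ψ : (Fin n → (Fin D → ℝ)) → Bool, Measurable ψ ∧
    (iidSamples n (gaussPi (0 : Fin D → ℝ))) {x | ψ x = true} ≤ 1/4 ∧
    ∀ θ ∈ Γ, ε ≤ euclNorm θ →
      (iidSamples n (gaussPi θ)) {x | ψ x = false} ≤ 1/4}

/-- Estimation sample complexity: the smallest `n` for which there is a measurable estimator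
whose worst-case expected squared Euclidean error over `Γ` is at most `ε²`. -/
noncomputable def nEst {D : ℕ} (Γ : Set (Fin D → ℝ)) (ε : ℝ) : ℕ :=
  sInf {n : ℕ | ∃ est : (Fin n → (Fin D → ℝ)) → (Fin D → ℝ), Measurable est ∧
    ∀ θ ∈ Γ,
      (∫⁻ x, ENNReal.ofReal (∑ i, (est x i - θ i) ^ 2) ∂(iidSamples n (gaussPi θ)))
        ≤ ENNReal.ofReal (ε ^ 2)}

/-- The LFHT projection test: accept `H₁` iff
`‖P(θ̂_X − θ̂_Z)‖₂² ≥ ‖P(θ̂_Y − θ̂_Z)‖₂²`, where `θ̂_X, θ̂_Y, θ̂_Z` are the sample means. -/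
noncomputable def lfhtProjTest {D : ℕ} (P : (Fin D → ℝ) →ₗ[ℝ] (Fin D → ℝ)) (m n : ℕ)
    (p : (Fin n → (Fin D → ℝ)) × (Fin n → (Fin D → ℝ)) × (Fin m → (Fin D → ℝ))) : Bool :=
  let θX : Fin D → ℝ := fun i => (∑ k, p.1 k i) / n
  let θY : Fin D → ℝ := fun i => (∑ k, p.2.1 k i) / n
  let θZ : Fin D → ℝ := fun i => (∑ j, p.2.2 j i) / m
  decide (∑ i, (P (θY - θZ) i) ^ 2 ≤ ∑ i, (P (θX - θZ) i) ^ 2)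

/-- `X` is a Gaussian vector with mean `θ` and covariance matrix `s • I_D`. -/
structure HasIsoGaussianLaw {Ω : Type*} [MeasurableSpace Ω] {D : ℕ} (X : Ω → Fin D → ℝ)
    (θ : Fin D → ℝ) (s : ℝ) (μ : Measure Ω) : Prop where
  hasGaussianLaw : HasGaussianLaw X μ
  integral_eval : ∀ i, ∫ ω, X ω i ∂μ = θ i
  covariance_eval : ∀ i j, cov[fun ω => X ω i, fun ω => X ω j; μ] = if i = j then s else 0

section Moments

variable {Ω Ω' : Type*} [MeasurableSpace Ω] [MeasurableSpace Ω'] {D : ℕ} {μ : Measure Ω}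
  {ν : Measure Ω'}

theorem ProbabilityTheory.HasGaussianLaw.memLp_eval {X : Ω → Fin D → ℝ} (hX : HasGaussianLaw X μ) (i : Fin D)
    {p : ENNReal} (hp : p ≠ ⊤) : MemLp (fun ω => X ω i) p μ :=
  (hX.map_fun (ContinuousLinearMap.proj (R := ℝ) (φ := fun _ : Fin D => ℝ) i)).memLp hp

theorem HasIsoGaussianLaw.memLp_two {X : Ω → Fin D → ℝ} {θ : Fin D → ℝ} {s : ℝ}
    (hX : HasIsoGaussianLaw X θ s μ) (i : Fin D) : MemLp (fun ω => X ω i) 2 μ :=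
  hX.hasGaussianLaw.memLp_eval i (by simp)

theorem HasIsoGaussianLaw.integrable_eval {X : Ω → Fin D → ℝ} {θ : Fin D → ℝ} {s : ℝ}
    (hX : HasIsoGaussianLaw X θ s μ) (i : Fin D) : Integrable (fun ω => X ω i) μ :=
  memLp_one_iff_integrable.1 (hX.hasGaussianLaw.memLp_eval i (by simp))

theorem HasIsoGaussianLaw.comp_measurePreserving {X : Ω → Fin D → ℝ} {θ : Fin D → ℝ} {s : ℝ}
    (hX : HasIsoGaussianLaw X θ s μ) {f : Ω' → Ω} (hf : MeasurePreserving f ν μ) :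
    HasIsoGaussianLaw (fun ω => X (f ω)) θ s ν := by
  have hae : AEMeasurable X (ν.map f) := by rw [hf.map_eq]; exact hX.hasGaussianLaw.aemeasurable
  have hmeas : ∀ i, AEStronglyMeasurable (fun ω => X ω i) (ν.map f) := fun i => by
    rw [hf.map_eq]; exact (hX.memLp_two i).aestronglyMeasurable
  refine ⟨⟨?_⟩, fun i => ?_, fun i j => ?_⟩
  · change IsGaussian (ν.map (X ∘ f))
    rw [← AEMeasurable.map_map_of_aemeasurable hae hf.aemeasurable, hf.map_eq]
    exact hX.hasGaussianLaw.isGaussian_map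
  · rw [← hX.integral_eval i, ← hf.map_eq, integral_map hf.aemeasurable (hmeas i)]
  · rw [← hX.covariance_eval i j, ← hf.map_eq,
      covariance_map_fun (hmeas i) (hmeas j) hf.aemeasurable]

theorem hasIsoGaussianLaw_gaussPi (θ : Fin D → ℝ) :
    HasIsoGaussianLaw (fun x => x) θ 1 (gaussPi θ) := by
  have hmp : ∀ i, MeasurePreserving (Function.eval i) (gaussPi θ) (gaussianReal (θ i) 1) :=
    fun i => measurePreserving_eval (fun i => gaussianReal (θ i) 1) i
  have hG : ∀ i, HasGaussianLaw (fun x : Fin D → ℝ => x i) (gaussPi θ) := fun i =>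
    ⟨by rw [show (fun x : Fin D → ℝ => x i) = Function.eval i from rfl, (hmp i).map_eq]
        infer_instance⟩
  have hind : iIndepFun (fun i (x : Fin D → ℝ) => x i) (gaussPi θ) :=
    iIndepFun_pi (X := fun _ => id) fun _ => aemeasurable_id
  refine ⟨hind.hasGaussianLaw hG, fun i => ?_, fun i j => ?_⟩
  · rw [← integral_id_gaussianReal (μ := θ i) (v := 1), ← (hmp i).map_eq,
      integral_map (hmp i).aemeasurable (by fun_prop)]
  · split_ifs with h
    · subst h
      rw [covariance_self (hG i).aemeasurable]
      have := variance_map (X := id) (μ := gaussPi θ) (Y := Function.eval i) (by fun_prop)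
        (hmp i).aemeasurable
      rw [(hmp i).map_eq, variance_id_gaussianReal] at this
      simpa using! this.symm
    · exact (hind.indepFun h).covariance_eq_zero (hG i).memLp_two (hG j).memLp_two

instance isProbabilityMeasure_gaussPi (θ : Fin D → ℝ) : IsProbabilityMeasure (gaussPi θ) := by
  unfold gaussPi; infer_instance

instance isProbabilityMeasure_iidSamples {E : Type*} [MeasurableSpace E] (n : ℕ) (ρ : Measure E)
    [IsProbabilityMeasure ρ] : IsProbabilityMeasure (iidSamples n ρ) := by
  unfold iidSamples; infer_instance

/-- The sample mean of `n` observations in `ℝ^D`. -/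
noncomputable def sampleMean (n : ℕ) (x : Fin n → Fin D → ℝ) : Fin D → ℝ :=
  fun i => (∑ k, x k i) / n

theorem hasIsoGaussianLaw_sampleMean (θ : Fin D → ℝ) {n : ℕ} (hn : 0 < n) :
    HasIsoGaussianLaw (sampleMean n) θ (1 / n) (iidSamples n (gaussPi θ)) := by
  have hn' : (n : ℝ) ≠ 0 := by positivity
  have hk : ∀ k : Fin n, HasIsoGaussianLaw (fun x : Fin n → Fin D → ℝ => x k) θ 1
      (iidSamples n (gaussPi θ)) := fun k =>
    (hasIsoGaussianLaw_gaussPi θ).comp_measurePreserving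
      (measurePreserving_eval (fun _ : Fin n => gaussPi θ) k)
  have hind : iIndepFun (fun k (x : Fin n → Fin D → ℝ) => x k) (iidSamples n (gaussPi θ)) :=
    iIndepFun_pi (X := fun _ => id) fun _ => aemeasurable_id
  refine ⟨?_, fun i => ?_, fun i j => ?_⟩
  · have heq : sampleMean n = fun x : Fin n → Fin D → ℝ => (n : ℝ)⁻¹ • ∑ k, x k := by
      ext x i; simp [sampleMean, div_eq_inv_mul]
    rw [heq]
    exact (hind.hasGaussianLaw_fun_sum fun k => (hk k).hasGaussianLaw).fun_smul _
  · simp only [sampleMean]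
    rw [integral_div, integral_finsetSum _ fun k _ => (hk k).integrable_eval i]
    simp [(hk _).integral_eval, hn']
  · have hcov : ∀ k l : Fin n, cov[fun x : Fin n → Fin D → ℝ => x k i, fun x => x l j;
        iidSamples n (gaussPi θ)] = if k = l then (if i = j then 1 else 0) else 0 := fun k l => by
      split_ifs with h h'
      · subst h; simpa [h'] using (hk k).covariance_eval i j
      · subst h; simpa [h'] using (hk k).covariance_eval i j
      · exact ((hind.indepFun h).comp (measurable_pi_apply i)
          (measurable_pi_apply j)).covariance_eq_zero ((hk k).memLp_two i) ((hk l).memLp_two j)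
    simp only [sampleMean]
    rw [covariance_fun_div_left, covariance_fun_div_right, covariance_fun_sum_fun_sum
      (fun k => (hk k).memLp_two i) (fun k => (hk k).memLp_two j)]
    simp only [hcov]
    split_ifs <;> simp [hn']

theorem memLp_two_mul_eval {W V : Ω → Fin D → ℝ} (hW : HasGaussianLaw W μ)
    (hV : HasGaussianLaw V μ) (k : Fin D) : MemLp (fun ω => W ω k * V ω k) 2 μ := by
  have : ENNReal.HolderTriple 4 4 2 := ⟨by
    rw [← ENNReal.toReal_eq_toReal_iff' (by simp) (by simp), ENNReal.toReal_add (by simp) (by simp)]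
    norm_num⟩
  exact (hV.memLp_eval k (p := 4) (by simp)).mul' (hW.memLp_eval k (p := 4) (by simp))

/-- For independent pairs `(W₁, W₂)` and `(V₁, V₂)`, the covariance of `W₁ V₁` and `W₂ V₂`
is determined by the first two moments of each pair. -/
theorem covariance_mul_mul_of_indepFun [IsProbabilityMeasure μ] {W V : Ω → Fin D → ℝ}
    (hW : HasGaussianLaw W μ) (hV : HasGaussianLaw V μ) (h : IndepFun W V μ) (i j : Fin D) :
    cov[fun ω => W ω i * V ω i, fun ω => W ω j * V ω j; μ] =
      (cov[fun ω => W ω i, fun ω => W ω j; μ] + (∫ ω, W ω i ∂μ) * ∫ ω, W ω j ∂μ) *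
        (cov[fun ω => V ω i, fun ω => V ω j; μ] + (∫ ω, V ω i ∂μ) * ∫ ω, V ω j ∂μ) -
      ((∫ ω, W ω i ∂μ) * ∫ ω, V ω i ∂μ) * ((∫ ω, W ω j ∂μ) * ∫ ω, V ω j ∂μ) := by
  have hWm := fun k => hW.memLp_eval k (p := 2) (by simp)
  have hVm := fun k => hV.memLp_eval k (p := 2) (by simp)
  have hWV := fun k => memLp_two_mul_eval hW hV k
  have hmean : ∀ k, ∫ ω, W ω k * V ω k ∂μ = (∫ ω, W ω k ∂μ) * ∫ ω, V ω k ∂μ := fun k =>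
    IndepFun.integral_fun_mul_eq_mul_integral
      (h.comp (measurable_pi_apply k) (measurable_pi_apply k))
      (hWm k).aestronglyMeasurable (hVm k).aestronglyMeasurable
  have hprod : ∫ ω, (W ω i * W ω j) * (V ω i * V ω j) ∂μ =
      (∫ ω, W ω i * W ω j ∂μ) * ∫ ω, V ω i * V ω j ∂μ := by
    have hφ : Measurable fun x : Fin D → ℝ => x i * x j := by fun_prop
    exact IndepFun.integral_fun_mul_eq_mul_integral (h.comp hφ hφ)
      ((hWm i).aestronglyMeasurable.mul (hWm j).aestronglyMeasurable)
      ((hVm i).aestronglyMeasurable.mul (hVm j).aestronglyMeasurable)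
  rw [covariance_eq_sub (hWV i) (hWV j), covariance_eq_sub (hWm i) (hWm j),
    covariance_eq_sub (hVm i) (hVm j), hmean i, hmean j, sub_add_cancel, sub_add_cancel]
  simp only [Pi.mul_apply]
  rw [← hprod]
  congr 2
  ext ω
  ring

end Moments

section LinearCombinations

variable {Ω : Type*} [MeasurableSpace Ω] {D : ℕ} {μ : Measure Ω}

theorem HasIsoGaussianLaw.const_smul {X : Ω → Fin D → ℝ} {θ : Fin D → ℝ} {s : ℝ}
    (hX : HasIsoGaussianLaw X θ s μ) (c : ℝ) :
    HasIsoGaussianLaw (fun ω => c • X ω) (c • θ) (c ^ 2 * s) μ := by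
  refine ⟨hX.hasGaussianLaw.fun_smul c, fun i => ?_, fun i j => ?_⟩
  · simp [integral_const_mul, hX.integral_eval]
  · simp only [Pi.smul_apply, smul_eq_mul]
    rw [covariance_const_mul_left, covariance_const_mul_right, hX.covariance_eval]
    split_ifs <;> ring

theorem covariance_eval_eq_zero_of_indepFun {X Y : Ω → Fin D → ℝ} (hX : HasGaussianLaw X μ)
    (hY : HasGaussianLaw Y μ) (h : IndepFun X Y μ) (i j : Fin D) :
    cov[fun ω => X ω i, fun ω => Y ω j; μ] = 0 :=
  (h.comp (measurable_pi_apply i) (measurable_pi_apply j)).covariance_eq_zero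
    (hX.memLp_eval i (by simp)) (hY.memLp_eval j (by simp))

theorem indepFun_comp_measurePreserving {Ω' E F : Type*} [MeasurableSpace Ω'] [MeasurableSpace E]
    [MeasurableSpace F] {ν : Measure Ω'} {X : Ω → E} {Y : Ω → F} {f : Ω' → Ω}
    (h : IndepFun X Y μ) (hX : Measurable X) (hY : Measurable Y)
    (hf : MeasurePreserving f ν μ) : IndepFun (fun ω => X (f ω)) (fun ω => Y (f ω)) ν := by
  rw [indepFun_iff_measure_inter_preimage_eq_mul] at h ⊢
  intro S T hS hT
  have := h S T hS hT
  rw [← hf.measure_preimage ((hX hS).inter (hY hT)).nullMeasurableSet,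
    ← hf.measure_preimage (hX hS).nullMeasurableSet,
    ← hf.measure_preimage (hY hT).nullMeasurableSet] at this
  exact this

theorem covariance_add_add [IsFiniteMeasure μ] {X Y Z T : Ω → ℝ} (hX : MemLp X 2 μ)
    (hY : MemLp Y 2 μ) (hZ : MemLp Z 2 μ) (hT : MemLp T 2 μ) :
    cov[fun ω => X ω + Y ω, fun ω => Z ω + T ω; μ] =
      cov[X, Z; μ] + cov[X, T; μ] + (cov[Y, Z; μ] + cov[Y, T; μ]) := by
  change cov[X + Y, Z + T; μ] = _
  rw [covariance_add_left hX hY (hZ.add hT), covariance_add_right hX hZ hT,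
    covariance_add_right hY hZ hT]

theorem HasIsoGaussianLaw.add [IsProbabilityMeasure μ] {X Y : Ω → Fin D → ℝ}
    {θ η : Fin D → ℝ} {s t : ℝ} (hX : HasIsoGaussianLaw X θ s μ)
    (hY : HasIsoGaussianLaw Y η t μ) (h : IndepFun X Y μ) :
    HasIsoGaussianLaw (fun ω => X ω + Y ω) (θ + η) (s + t) μ := by
  refine ⟨(h.hasGaussianLaw hX.hasGaussianLaw hY.hasGaussianLaw).fun_add, fun i => ?_,
    fun i j => ?_⟩
  · simp only [Pi.add_apply]
    rw [integral_add (hX.integrable_eval i) (hY.integrable_eval i), hX.integral_eval,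
      hY.integral_eval]
  · simp only [Pi.add_apply]
    rw [covariance_add_add (hX.memLp_two i) (hY.memLp_two i) (hX.memLp_two j) (hY.memLp_two j),
      hX.covariance_eval, hY.covariance_eval,
      covariance_eval_eq_zero_of_indepFun hX.hasGaussianLaw hY.hasGaussianLaw h,
      covariance_eval_eq_zero_of_indepFun hY.hasGaussianLaw hX.hasGaussianLaw h.symm]
    split_ifs <;> ring

/-- If `X` and `Y` are Gaussian with the same isotropic covariance and `X`, `Y`, `Z` are
independent, then `X - Y` and `X + Y - 2 Z` are independent. -/
theorem indepFun_sub_add [IsProbabilityMeasure μ] {X Y Z : Ω → Fin D → ℝ}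
    {θ₁ θ₂ θ : Fin D → ℝ} {s t : ℝ} (hX : HasIsoGaussianLaw X θ₁ s μ)
    (hY : HasIsoGaussianLaw Y θ₂ s μ) (hZ : HasIsoGaussianLaw Z θ t μ)
    (hXYZ : IndepFun X (fun ω => (Y ω, Z ω)) μ) (hYZ : IndepFun Y Z μ) :
    IndepFun (fun ω => X ω + (-1 : ℝ) • Y ω) (fun ω => X ω + (Y ω + (-2 : ℝ) • Z ω)) μ := by
  have hXY : IndepFun X Y μ := hXYZ.comp measurable_id measurable_fst
  have hXZ : IndepFun X Z μ := hXYZ.comp measurable_id measurable_snd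
  let E := Fin D → ℝ
  let pX : E × E × E →L[ℝ] E := .fst ℝ E (E × E)
  let pY : E × E × E →L[ℝ] E := (ContinuousLinearMap.fst ℝ E E).comp (.snd ℝ E (E × E))
  let pZ : E × E × E →L[ℝ] E := (ContinuousLinearMap.snd ℝ E E).comp (.snd ℝ E (E × E))
  have hjoint := (hXYZ.hasGaussianLaw hX.hasGaussianLaw
    (hYZ.hasGaussianLaw hY.hasGaussianLaw hZ.hasGaussianLaw)).map_fun
      ((pX + (-1 : ℝ) • pY).prod (pX + (pY + (-2 : ℝ) • pZ)))
  refine HasGaussianLaw.indepFun_of_covariance_eval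
    (X := fun i ω => (X ω + (-1 : ℝ) • Y ω) i)
    (Y := fun i ω => (X ω + (Y ω + (-2 : ℝ) • Z ω)) i) hjoint fun i j => ?_
  simp only [Pi.add_apply, Pi.smul_apply, smul_eq_mul]
  have hZ' := (hZ.memLp_two j).const_mul (-2)
  rw [covariance_add_add (hX.memLp_two i) ((hY.memLp_two i).const_mul _) (hX.memLp_two j)
      (T := fun ω => Y ω j + -2 * Z ω j) ((hY.memLp_two j).add hZ')]
  have hr : ∀ W : Ω → ℝ, MemLp W 2 μ → cov[W, fun ω => Y ω j + -2 * Z ω j; μ] =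
      cov[W, fun ω => Y ω j; μ] + -2 * cov[W, fun ω => Z ω j; μ] := fun W hW => by
    rw [← covariance_const_mul_right]
    exact covariance_add_right hW (hY.memLp_two j) hZ'
  rw [hr _ (hX.memLp_two i), hr _ ((hY.memLp_two i).const_mul _)]
  simp only [covariance_const_mul_left]
  rw [hX.covariance_eval, hY.covariance_eval,
    covariance_eval_eq_zero_of_indepFun hX.hasGaussianLaw hY.hasGaussianLaw hXY,
    covariance_eval_eq_zero_of_indepFun hX.hasGaussianLaw hZ.hasGaussianLaw hXZ,
    covariance_eval_eq_zero_of_indepFun hY.hasGaussianLaw hX.hasGaussianLaw hXY.symm,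
    covariance_eval_eq_zero_of_indepFun hY.hasGaussianLaw hZ.hasGaussianLaw hYZ]
  ring

end LinearCombinations

section BilinearForm

open Matrix

variable {Ω : Type*} [MeasurableSpace Ω] {D : ℕ} {μ : Measure Ω}
  {U V : Ω → Fin D → ℝ} {a b : Fin D → ℝ} {s t : ℝ}

theorem HasIsoGaussianLaw.hasGaussianLaw_mulVec (hU : HasIsoGaussianLaw U a s μ)
    (A : Matrix (Fin D) (Fin D) ℝ) : HasGaussianLaw (fun ω => A *ᵥ U ω) μ :=
  hU.hasGaussianLaw.map_fun (LinearMap.toContinuousLinearMap A.mulVecLin)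

theorem HasIsoGaussianLaw.integral_mulVec (hU : HasIsoGaussianLaw U a s μ)
    (A : Matrix (Fin D) (Fin D) ℝ) (i : Fin D) : ∫ ω, (A *ᵥ U ω) i ∂μ = (A *ᵥ a) i := by
  simp only [mulVec, dotProduct]
  rw [integral_finsetSum _ fun k _ => (hU.integrable_eval k).const_mul _]
  simp [integral_const_mul, hU.integral_eval]

theorem HasIsoGaussianLaw.covariance_mulVec [IsProbabilityMeasure μ] (hU : HasIsoGaussianLaw U a s μ)
    (A : Matrix (Fin D) (Fin D) ℝ) (i j : Fin D) :
    cov[fun ω => (A *ᵥ U ω) i, fun ω => (A *ᵥ U ω) j; μ] = s * (A * Aᵀ) i j := by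
  simp only [mulVec, dotProduct]
  rw [covariance_fun_sum_fun_sum (fun k => (hU.memLp_two k).const_mul _)
    (fun k => (hU.memLp_two k).const_mul _)]
  simp only [covariance_const_mul_left, covariance_const_mul_right, hU.covariance_eval,
    Matrix.mul_apply, transpose_apply, Finset.mul_sum]
  refine Finset.sum_congr rfl fun k _ => ?_
  simp only [mul_ite, mul_zero, Finset.sum_ite_eq, Finset.mem_univ, if_true]
  ring

theorem integral_mulVec_dotProduct [IsProbabilityMeasure μ] (hU : HasIsoGaussianLaw U a s μ)
    (hV : HasIsoGaussianLaw V b t μ) (h : IndepFun U V μ) (A : Matrix (Fin D) (Fin D) ℝ) :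
    ∫ ω, (A *ᵥ U ω) ⬝ᵥ V ω ∂μ = (A *ᵥ a) ⬝ᵥ b := by
  have hA : Measurable fun x : Fin D → ℝ => A *ᵥ x :=
    (LinearMap.toContinuousLinearMap A.mulVecLin).continuous.measurable
  have hW := hU.hasGaussianLaw_mulVec A
  have hWV : IndepFun (fun ω => A *ᵥ U ω) V μ := h.comp hA measurable_id
  simp only [dotProduct]
  rw [integral_finsetSum _ fun k _ =>
    (memLp_two_mul_eval hW hV.hasGaussianLaw k).integrable (by norm_num)]
  refine Finset.sum_congr rfl fun k _ => ?_
  rw [← hU.integral_mulVec, ← hV.integral_eval]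
  exact IndepFun.integral_fun_mul_eq_mul_integral
    (hWV.comp (measurable_pi_apply k) (measurable_pi_apply k))
    (hW.memLp_eval k (p := 2) (by simp)).aestronglyMeasurable (hV.memLp_two k).aestronglyMeasurable

theorem variance_mulVec_dotProduct [IsProbabilityMeasure μ] (hU : HasIsoGaussianLaw U a s μ)
    (hV : HasIsoGaussianLaw V b t μ) (h : IndepFun U V μ) (A : Matrix (Fin D) (Fin D) ℝ) :
    Var[fun ω => (A *ᵥ U ω) ⬝ᵥ V ω; μ] =
      s * t * (A * Aᵀ).trace + s * (b ⬝ᵥ ((A * Aᵀ) *ᵥ b)) + t * ((A *ᵥ a) ⬝ᵥ (A *ᵥ a)) := by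
  have hA : Measurable fun x : Fin D → ℝ => A *ᵥ x :=
    (LinearMap.toContinuousLinearMap A.mulVecLin).continuous.measurable
  have hW := hU.hasGaussianLaw_mulVec A
  have hWV : IndepFun (fun ω => A *ᵥ U ω) V μ := h.comp hA measurable_id
  simp only [dotProduct]
  rw [variance_fun_sum fun k => memLp_two_mul_eval hW hV.hasGaussianLaw k]
  simp only [covariance_mul_mul_of_indepFun hW hV.hasGaussianLaw hWV, hU.integral_mulVec,
    hV.integral_eval, hU.covariance_mulVec, hV.covariance_eval]
  generalize A * Aᵀ = B
  generalize A *ᵥ a = w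
  simp only [Matrix.trace, Matrix.diag, mulVec, dotProduct, Finset.mul_sum]
  rw [← Finset.sum_add_distrib, ← Finset.sum_add_distrib]
  refine Finset.sum_congr rfl fun i _ => ?_
  have : ∀ j, (s * B i j + w i * w j) * ((if i = j then t else 0) + b i * b j) -
      w i * b i * (w j * b j) = (if i = j then s * t * B i j + t * (w i * w j) else 0) +
        s * (b i * (B i j * b j)) := fun j => by split_ifs <;> ring
  simp only [this, Finset.sum_add_distrib, Finset.sum_ite_eq, Finset.mem_univ, if_true]
  ring

end BilinearForm

section Projection

open Matrix

variable {D : ℕ} {P : (Fin D → ℝ) →ₗ[ℝ] (Fin D → ℝ)}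

theorem dotProduct_apply_apply (hsym : ∀ x y : Fin D → ℝ, ∑ i, P x i * y i = ∑ i, x i * P y i)
    (hidem : ∀ x, P (P x) = P x) (x y : Fin D → ℝ) : P x ⬝ᵥ P y = P x ⬝ᵥ y := by
  have := hsym (P x) y
  rw [hidem] at this
  exact this.symm

theorem toMatrix'_mul_transpose_self
    (hsym : ∀ x y : Fin D → ℝ, ∑ i, P x i * y i = ∑ i, x i * P y i)
    (hidem : ∀ x, P (P x) = P x) :
    LinearMap.toMatrix' P * (LinearMap.toMatrix' P)ᵀ = LinearMap.toMatrix' P := by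
  have ht : (LinearMap.toMatrix' P)ᵀ = LinearMap.toMatrix' P := by
    ext i j
    simpa [LinearMap.toMatrix'_apply, Pi.single_apply] using
      hsym (Pi.single i 1) (Pi.single j 1)
  rw [ht, ← LinearMap.toMatrix'_comp]
  congr 1
  exact LinearMap.ext hidem

theorem trace_toMatrix'_eq_finrank_range (hidem : ∀ x, P (P x) = P x) :
    (LinearMap.toMatrix' P).trace = Module.finrank ℝ (LinearMap.range P) := by
  have hP : IsIdempotentElem P := LinearMap.ext hidem
  rw [← (LinearMap.IsIdempotentElem.isProj_range P hP).trace,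
    LinearMap.trace_eq_matrix_trace ℝ (Pi.basisFun ℝ (Fin D)), LinearMap.toMatrix_eq_toMatrix']

/-- Pythagoras for a symmetric idempotent. -/
theorem dotProduct_self_eq_add (hsym : ∀ x y : Fin D → ℝ, ∑ i, P x i * y i = ∑ i, x i * P y i)
    (hidem : ∀ x, P (P x) = P x) (x : Fin D → ℝ) :
    x ⬝ᵥ x = P x ⬝ᵥ P x + (x - P x) ⬝ᵥ (x - P x) := by
  have h := dotProduct_apply_apply hsym hidem x x
  simp only [sub_dotProduct, dotProduct_sub]
  rw [dotProduct_comm x (P x)]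
  linarith

theorem euclNorm_eq_norm (x : Fin D → ℝ) : euclNorm x = ‖WithLp.toLp 2 x‖ := by
  simp [euclNorm, EuclideanSpace.norm_eq]

theorem euclNorm_sq (x : Fin D → ℝ) : euclNorm x ^ 2 = x ⬝ᵥ x := by
  rw [euclNorm, Real.sq_sqrt (Finset.sum_nonneg fun i _ => sq_nonneg _)]
  simp [dotProduct, sq]

theorem separation_of_approx (hsym : ∀ x y : Fin D → ℝ, ∑ i, P x i * y i = ∑ i, x i * P y i)
    (hidem : ∀ x, P (P x) = P x) {ε : ℝ} (hε : 0 < ε) {θ₁ θ₂ : Fin D → ℝ}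
    (h₁ : euclNorm (θ₁ - P θ₁) ≤ ε / 3) (h₂ : euclNorm (θ₂ - P θ₂) ≤ ε / 3)
    (hsep : ε ≤ euclNorm (θ₁ - θ₂)) :
    5 / 9 * ε ^ 2 ≤ P (θ₁ - θ₂) ⬝ᵥ P (θ₁ - θ₂) := by
  have hres : euclNorm ((θ₁ - θ₂) - P (θ₁ - θ₂)) ≤ 2 * ε / 3 := by
    have : (θ₁ - θ₂) - P (θ₁ - θ₂) = (θ₁ - P θ₁) - (θ₂ - P θ₂) := by
      rw [map_sub]; abel
    rw [euclNorm_eq_norm] at h₁ h₂ ⊢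
    rw [this, WithLp.toLp_sub]
    exact (norm_sub_le _ _).trans (by linarith)
  have hnn : 0 ≤ euclNorm ((θ₁ - θ₂) - P (θ₁ - θ₂)) := Real.sqrt_nonneg _
  have hpyth := dotProduct_self_eq_add hsym hidem (θ₁ - θ₂)
  rw [← euclNorm_sq (θ₁ - θ₂), ← euclNorm_sq (_ - P _)] at hpyth
  nlinarith

theorem dotProduct_self_sub_dotProduct_self
    (hsym : ∀ x y : Fin D → ℝ, ∑ i, P x i * y i = ∑ i, x i * P y i)
    (hidem : ∀ x, P (P x) = P x) (x y z : Fin D → ℝ) :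
    P (x - z) ⬝ᵥ P (x - z) - P (y - z) ⬝ᵥ P (y - z) =
      P (x + (-1 : ℝ) • y) ⬝ᵥ (x + (y + (-2 : ℝ) • z)) := by
  have hd : x + (-1 : ℝ) • y = (x - z) - (y - z) := by module
  have hs : x + (y + (-2 : ℝ) • z) = (x - z) + (y - z) := by module
  rw [hd, hs, ← dotProduct_apply_apply hsym hidem (_ - _) (_ + _), map_sub P (x - z),
    map_add P (x - z)]
  simp only [sub_dotProduct, dotProduct_add]
  rw [dotProduct_comm (P (y - z)) (P (x - z))]
  ring

end Projection

section Test

open Matrix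

variable {D : ℕ} {P : (Fin D → ℝ) →ₗ[ℝ] (Fin D → ℝ)}

/-- Difference of squared projected distances of the two training means to the test mean. -/
noncomputable def projStatistic (P : (Fin D → ℝ) →ₗ[ℝ] (Fin D → ℝ)) (m n : ℕ)
    (p : (Fin n → (Fin D → ℝ)) × (Fin n → (Fin D → ℝ)) × (Fin m → (Fin D → ℝ))) : ℝ :=
  P (sampleMean n p.1 + (-1 : ℝ) • sampleMean n p.2.1) ⬝ᵥ
    (sampleMean n p.1 + (sampleMean n p.2.1 + (-2 : ℝ) • sampleMean m p.2.2))

theorem lfhtProjTest_eq_decide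
    (hsym : ∀ x y : Fin D → ℝ, ∑ i, P x i * y i = ∑ i, x i * P y i)
    (hidem : ∀ x, P (P x) = P x) (m n : ℕ)
    (p : (Fin n → (Fin D → ℝ)) × (Fin n → (Fin D → ℝ)) × (Fin m → (Fin D → ℝ))) :
    lfhtProjTest P m n p = decide (0 ≤ projStatistic P m n p) := by
  rw [projStatistic, ← dotProduct_self_sub_dotProduct_self hsym hidem]
  simp only [sub_nonneg, dotProduct, ← sq]
  rfl

theorem measurable_sampleMean (n : ℕ) : Measurable (sampleMean (D := D) n) := by
  unfold sampleMean
  fun_prop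

/-- Chebyshev bound for the projection statistic, where the mean `b` of the second factor is
`±(θ₁ - θ₂)`. -/
theorem measure_projStatistic_deviation_le
    (hsym : ∀ x y : Fin D → ℝ, ∑ i, P x i * y i = ∑ i, x i * P y i)
    (hidem : ∀ x, P (P x) = P x) {m n : ℕ} (hm : 0 < m) (hn : 0 < n) (θ₁ θ₂ θ : Fin D → ℝ)
    (hb : θ₁ + (θ₂ + (-2 : ℝ) • θ) = θ₁ - θ₂ ∨ θ₁ + (θ₂ + (-2 : ℝ) • θ) = -(θ₁ - θ₂)) {q : ℝ}
    (hq : P (θ₁ - θ₂) ⬝ᵥ P (θ₁ - θ₂) = q) (hqpos : 0 < q) :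
    ((iidSamples n (gaussPi θ₁)).prod
        ((iidSamples n (gaussPi θ₂)).prod (iidSamples m (gaussPi θ))))
      {p | q ≤ |projStatistic P m n p - P (θ₁ - θ₂) ⬝ᵥ (θ₁ + (θ₂ + (-2 : ℝ) • θ))|} ≤
    ENNReal.ofReal (((2 / n) * (2 / n + 4 / m) * Module.finrank ℝ (LinearMap.range P) +
      (4 / n + 4 / m) * q) / q ^ 2) := by
  set μ₁ := iidSamples n (gaussPi θ₁)
  set μ₂ := iidSamples n (gaussPi θ₂)
  set μ₃ := iidSamples m (gaussPi θ)
  set μ := μ₁.prod (μ₂.prod μ₃)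
  have hX : HasIsoGaussianLaw (fun p => sampleMean n p.1) θ₁ (1 / n) μ :=
    (hasIsoGaussianLaw_sampleMean θ₁ hn).comp_measurePreserving measurePreserving_fst
  have hY : HasIsoGaussianLaw (fun p => sampleMean n p.2.1) θ₂ (1 / n) μ :=
    (hasIsoGaussianLaw_sampleMean θ₂ hn).comp_measurePreserving
      (measurePreserving_fst.comp measurePreserving_snd)
  have hZ : HasIsoGaussianLaw (fun p => sampleMean m p.2.2) θ (1 / m) μ :=
    (hasIsoGaussianLaw_sampleMean θ hm).comp_measurePreserving
      (measurePreserving_snd.comp measurePreserving_snd)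
  have hXYZ : IndepFun (fun p => sampleMean n p.1)
      (fun p => (sampleMean n p.2.1, sampleMean m p.2.2)) μ :=
    indepFun_prod (Y := fun p : (Fin n → Fin D → ℝ) × (Fin m → Fin D → ℝ) =>
      (sampleMean n p.1, sampleMean m p.2)) (measurable_sampleMean n)
      (((measurable_sampleMean n).comp measurable_fst).prodMk
        ((measurable_sampleMean m).comp measurable_snd))
  have hYZ : IndepFun (fun p => sampleMean n p.2.1) (fun p => sampleMean m p.2.2) μ := by
    have h := indepFun_prod (μ := μ₂) (ν := μ₃) (measurable_sampleMean (D := D) n)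
      (measurable_sampleMean (D := D) m)
    exact indepFun_comp_measurePreserving h ((measurable_sampleMean n).comp measurable_fst)
      ((measurable_sampleMean m).comp measurable_snd) measurePreserving_snd
  have hXY : IndepFun (fun p => sampleMean n p.1) (fun p => (-1 : ℝ) • sampleMean n p.2.1) μ :=
    hXYZ.comp measurable_id (measurable_fst.const_smul (-1 : ℝ))
  have hU := hX.add (hY.const_smul (-1)) hXY
  have hV := hX.add (hY.add (hZ.const_smul (-2)) (hYZ.comp measurable_id
    (measurable_const_smul (-2 : ℝ)))) (hXYZ.comp measurable_id
      (measurable_fst.add (measurable_snd.const_smul (-2 : ℝ))))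
  have hind := indepFun_sub_add hX hY hZ hXYZ hYZ
  have hAP : ∀ x, LinearMap.toMatrix' P *ᵥ x = P x := fun x => LinearMap.toMatrix'_mulVec P x
  have hmean := integral_mulVec_dotProduct hU hV hind (LinearMap.toMatrix' P)
  have hvar := variance_mulVec_dotProduct hU hV hind (LinearMap.toMatrix' P)
  have hbq : (θ₁ + (θ₂ + (-2 : ℝ) • θ)) ⬝ᵥ P (θ₁ + (θ₂ + (-2 : ℝ) • θ)) = q := by
    rw [dotProduct_comm, ← dotProduct_apply_apply hsym hidem]
    rcases hb with hb | hb <;> rw [hb]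
    · exact hq
    · rw [map_neg, neg_dotProduct_neg, hq]
  have hθ : θ₁ + (-1 : ℝ) • θ₂ = θ₁ - θ₂ := by module
  rw [toMatrix'_mul_transpose_self hsym hidem, trace_toMatrix'_eq_finrank_range hidem] at hvar
  simp only [hAP, hθ, hq, hbq] at hmean hvar
  have hL2 : MemLp (projStatistic P m n) 2 μ := by
    have := memLp_finsetSum Finset.univ fun k _ => memLp_two_mul_eval
      (hU.hasGaussianLaw_mulVec (LinearMap.toMatrix' P)) hV.hasGaussianLaw k
    simpa only [hAP] using! this
  have hcheb := meas_ge_le_variance_div_sq hL2 hqpos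
  unfold projStatistic at hcheb ⊢
  rw [hmean, hvar] at hcheb
  refine hcheb.trans (le_of_eq ?_)
  congr 2
  ring

theorem variance_bound_le_quarter {ε q M N d : ℝ} (hε : 0 < ε) (hq : 5 / 9 * ε ^ 2 ≤ q)
    (hd : 1 ≤ d) (hM : 96 / ε ^ 2 ≤ M) (hN : 96 * √d / ε ^ 2 ≤ N)
    (hMN : 768 * d / ε ^ 4 ≤ M * N) :
    ((2 / N) * (2 / N + 4 / M) * d + (4 / N + 4 / M) * q) / q ^ 2 ≤ 1 / 4 := by
  have hsd : 1 ≤ √d := Real.one_le_sqrt.2 hd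
  have hsq : √d * √d = d := Real.mul_self_sqrt (by linarith)
  have hMpos : 0 < M := lt_of_lt_of_le (by positivity) hM
  have hNpos : 0 < N := lt_of_lt_of_le (by positivity) hN
  have hqpos : 0 < q := lt_of_lt_of_le (by positivity) hq
  have hM' : 1 / M ≤ ε ^ 2 / 96 := by
    rw [div_le_iff₀ (by positivity)] at hM ⊢; linarith
  have hN' : √d / N ≤ ε ^ 2 / 96 := by
    rw [div_le_iff₀ (by positivity)] at hN ⊢; linarith
  have hN1 : 1 / N ≤ ε ^ 2 / 96 := le_trans (by gcongr) hN'
  have hMN' : d / (M * N) ≤ ε ^ 4 / 768 := by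
    rw [div_le_iff₀ (by positivity)] at hMN ⊢; linarith
  have hNN : d / N ^ 2 ≤ ε ^ 4 / 9216 := by
    calc d / N ^ 2 = (√d / N) ^ 2 := by rw [div_pow, sq (√d), hsq]
      _ ≤ (ε ^ 2 / 96) ^ 2 := by gcongr
      _ = ε ^ 4 / 9216 := by ring
  have hsplit : (2 / N) * (2 / N + 4 / M) * d + (4 / N + 4 / M) * q =
      4 * (d / N ^ 2) + 8 * (d / (M * N)) + (4 * (1 / N) + 4 * (1 / M)) * q := by
    field_simp
    ring
  have hε4 : ε ^ 4 ≤ 81 / 25 * q ^ 2 := by nlinarith [sq_nonneg ε]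
  rw [div_le_iff₀ (by positivity), hsplit]
  have hlin : (4 * (1 / N) + 4 * (1 / M)) * q ≤ (3 / 20 * q) * q := by
    gcongr
    linarith
  nlinarith [sq_nonneg q]

end Test

/-- If `P` is an orthogonal projection onto a `d`-dimensional subspace approximating `Γ`
within `ε/3`, and `m ≥ 96/ε²`, `n ≥ 96√d/ε²`, `mn ≥ 768 d/ε⁴`, then the projection test
errs with probability at most `1/4` under both hypotheses. -/
theorem lfht_proj_test_valid {D : ℕ} (hD : 0 < D) (Γ : Set (Fin D → ℝ))
    (ε : ℝ) (hε : 0 < ε) (d : ℕ)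
    (P : (Fin D → ℝ) →ₗ[ℝ] (Fin D → ℝ))
    (hsym : ∀ x y : Fin D → ℝ, ∑ i, P x i * y i = ∑ i, x i * P y i)
    (hidem : ∀ x, P (P x) = P x)
    (hrank : Module.finrank ℝ (LinearMap.range P) = d)
    (happrox : ∀ θ ∈ Γ, euclNorm (θ - P θ) ≤ ε / 3)
    (m n : ℕ) (hm : 96 / ε ^ 2 ≤ (m : ℝ)) (hn : 96 * Real.sqrt d / ε ^ 2 ≤ (n : ℝ))
    (hmn : 768 * d / ε ^ 4 ≤ (m : ℝ) * (n : ℝ)) :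
    ∀ θ1 ∈ Γ, ∀ θ2 ∈ Γ, ε ≤ euclNorm (θ1 - θ2) →
      (((iidSamples n (gaussPi θ1)).prod
          ((iidSamples n (gaussPi θ2)).prod (iidSamples m (gaussPi θ1))))
            {x | lfhtProjTest P m n x = true} ≤ 1/4 ∧
        ((iidSamples n (gaussPi θ1)).prod
          ((iidSamples n (gaussPi θ2)).prod (iidSamples m (gaussPi θ2))))
            {x | lfhtProjTest P m n x = false} ≤ 1/4) := by
  intro θ1 h1 θ2 h2 hsep
  have hq := separation_of_approx hsym hidem hε (happrox θ1 h1) (happrox θ2 h2) hsep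
  set q := P (θ1 - θ2) ⬝ᵥ P (θ1 - θ2) with hqdef
  have hqpos : 0 < q := lt_of_lt_of_le (by positivity) hq
  have hd : 1 ≤ d := by
    rw [Nat.one_le_iff_ne_zero]
    rintro rfl
    have hP : P = 0 := LinearMap.range_eq_bot.1 (Submodule.finrank_eq_zero.1 hrank)
    simp [hqdef, hP] at hqpos
  have hd' : (1 : ℝ) ≤ d := by exact_mod_cast hd
  have hm0 : 0 < m := by
    exact_mod_cast lt_of_lt_of_le (show (0 : ℝ) < 96 / ε ^ 2 by positivity) hm
  have hn0 : 0 < n := by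
    exact_mod_cast lt_of_lt_of_le (show (0 : ℝ) < 96 * √d / ε ^ 2 by positivity) hn
  have hbound := variance_bound_le_quarter hε hq hd' hm hn hmn
  have hquarter : ENNReal.ofReal (((2 / n) * (2 / n + 4 / m) * d + (4 / n + 4 / m) * q) / q ^ 2) ≤
      1 / 4 := by
    refine (ENNReal.ofReal_le_ofReal hbound).trans (le_of_eq ?_)
    rw [ENNReal.ofReal_div_of_pos (by norm_num)]
    simp
  have hself := dotProduct_apply_apply hsym hidem (θ1 - θ2) (θ1 - θ2)
  constructor
  · have hb : θ1 + (θ2 + (-2 : ℝ) • θ1) = -(θ1 - θ2) := by module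
    have hdev := measure_projStatistic_deviation_le hsym hidem hm0 hn0 θ1 θ2 θ1 (.inr hb)
      hqdef.symm hqpos
    rw [hrank] at hdev
    refine (measure_mono fun p hp => ?_).trans (hdev.trans hquarter)
    simp only [Set.mem_ofPred_eq, lfhtProjTest_eq_decide hsym hidem, decide_eq_true_eq] at hp ⊢
    rw [hb, dotProduct_neg, ← hself, ← hqdef, sub_neg_eq_add, abs_of_nonneg (by linarith)]
    linarith
  · have hb : θ1 + (θ2 + (-2 : ℝ) • θ2) = θ1 - θ2 := by module
    have hdev := measure_projStatistic_deviation_le hsym hidem hm0 hn0 θ1 θ2 θ2 (.inl hb)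
      hqdef.symm hqpos
    rw [hrank] at hdev
    refine (measure_mono fun p hp => ?_).trans (hdev.trans hquarter)
    simp only [Set.mem_ofPred_eq, lfhtProjTest_eq_decide hsym hidem, decide_eq_false_iff_not,
      not_le] at hp ⊢
    rw [hb, ← hself, ← hqdef, abs_of_neg (by linarith)]
    linarith
end

section
/- Let D be a positive integer and let Γ ⊆ ℝ^D be orthosymmetric and convex. Then for any θ = (θ₁,…,θ_D) ∈ Γ and any α = (α₁,…,α_D) ∈ [−1,1]^D, the coordinate-wise product (α₁θ₁, α₂θ₂, …, α_Dθ_D) lies in Γ. -/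
/-- An orthosymmetric convex set in `ℝ^D` is closed under coordinatewise multiplication by
vectors in `[−1, 1]^D`. -/
theorem orthosymmetric_convex_mul_mem {D : ℕ} (hD : 0 < D) (Γ : Set (Fin D → ℝ))
    (horth : Orthosymmetric Γ) (hconv : Convex ℝ Γ)
    (θ : Fin D → ℝ) (hθ : θ ∈ Γ) (α : Fin D → ℝ) (hα : ∀ i, α i ∈ Set.Icc (-1 : ℝ) 1) :
    (fun i => α i * θ i) ∈ Γ := by
  have hset : Convex ℝ {a : Fin D → ℝ | (fun i => a i * θ i) ∈ Γ} :=
    hconv.linear_preimage (LinearMap.mulRight ℝ θ)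
  refine convexHull_min (s := Set.univ.pi fun _ => {-1, 1}) ?_ hset ?_
  · exact fun s hs => horth θ hθ s fun i => (hs i trivial).symm
  · rw [convexHull_pi]
    intro i _
    rw [convexHull_pair, segment_eq_Icc (by norm_num)]
    exact hα i
end
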